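/- Let Z₁ and W be independent standard normal random variables on a probability space (Ω, P), let ρ ∈ [−1, 1], and set Z₂ := ρ·Z₁ + √(1−ρ²)·W. For a < b, μ ∈ ℝ and σ > 0, define X₁ := a + (b−a)·Φ(Z₁) (which has the uniform law on [a, b]) and X₂ := μ + σ·Z₂. Then cov(X₁, X₂) = ρ·σ·(b−a)/(2√π), and the Pearson correlation of X₁ and X₂ equals √(3/π)·ρ. -/

import Mathlib

open MeasureTheory ProbabilityTheory

/-- The standard normal density φ(z) = (1/√(2π))·e^{−z²/2}. -/
noncomputable def stdNormalPDF (z : ℝ) : ℝ :=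
  (Real.sqrt (2 * Real.pi))⁻¹ * Real.exp (-(z ^ 2) / 2)

/-- The standard normal cumulative distribution function Φ. -/
noncomputable def stdNormalCDF (x : ℝ) : ℝ :=
  ∫ z in Set.Iic x, stdNormalPDF z

/-- Covariance: cov(X, Y) = E[X·Y] − E[X]·E[Y]. -/
noncomputable def cov {Ω : Type*} [MeasurableSpace Ω] (P : Measure Ω) (X Y : Ω → ℝ) : ℝ :=
  (∫ ω, X ω * Y ω ∂P) - (∫ ω, X ω ∂P) * (∫ ω, Y ω ∂P)

/-- Pearson correlation: corr(X, Y) = cov(X, Y)/√(Var X · Var Y). -/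
noncomputable def corr {Ω : Type*} [MeasurableSpace Ω] (P : Measure Ω) (X Y : Ω → ℝ) : ℝ :=
  cov P X Y / Real.sqrt (cov P X X * cov P Y Y)

open Filter Topology

lemma stdNormalPDF_eq_gaussianPDFReal : stdNormalPDF = gaussianPDFReal 0 1 := by
  ext z
  simp [stdNormalPDF, gaussianPDFReal]

lemma continuous_stdNormalPDF : Continuous stdNormalPDF := by
  unfold stdNormalPDF
  fun_prop

lemma integrable_stdNormalPDF : Integrable stdNormalPDF := by
  rw [stdNormalPDF_eq_gaussianPDFReal]
  exact integrable_gaussianPDFReal 0 1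

lemma integrable_id_mul_stdNormalPDF : Integrable fun z ↦ z * stdNormalPDF z := by
  refine ((integrable_mul_exp_neg_mul_sq (b := 1 / 2) (by norm_num)).const_mul
    (Real.sqrt (2 * Real.pi))⁻¹).congr (ae_of_all _ fun z ↦ ?_)
  simp only [stdNormalPDF]
  rw [show -(1 / 2) * z ^ 2 = -(z ^ 2) / 2 by ring]
  ring

lemma hasDerivAt_stdNormalPDF (z : ℝ) : HasDerivAt stdNormalPDF (-z * stdNormalPDF z) z := by
  have h : HasDerivAt (fun z : ℝ ↦ -(z ^ 2) / 2) (-z) z := by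
    refine ((hasDerivAt_pow 2 z).neg.div_const 2).congr_deriv ?_
    push_cast
    ring
  refine (h.exp.const_mul (Real.sqrt (2 * Real.pi))⁻¹).congr_deriv ?_
  simp only [stdNormalPDF]
  ring

lemma integral_gaussianReal_eq_integral_stdNormalPDF_mul (f : ℝ → ℝ) :
    ∫ x, f x ∂gaussianReal 0 1 = ∫ x, stdNormalPDF x * f x := by
  rw [integral_gaussianReal_eq_integral_smul one_ne_zero, stdNormalPDF_eq_gaussianPDFReal]
  rfl

lemma stdNormalCDF_eq_cdf (x : ℝ) : stdNormalCDF x = cdf (gaussianReal 0 1) x := by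
  rw [cdf_eq_real, measureReal_def, gaussianReal_apply_eq_integral _ one_ne_zero,
    ENNReal.toReal_ofReal (integral_nonneg fun _ ↦ gaussianPDFReal_nonneg _ _ _),
    stdNormalCDF, stdNormalPDF_eq_gaussianPDFReal]

lemma abs_stdNormalCDF_le_one (x : ℝ) : |stdNormalCDF x| ≤ 1 := by
  rw [stdNormalCDF_eq_cdf, abs_of_nonneg (cdf_nonneg _ _)]
  exact cdf_le_one _ _

lemma tendsto_stdNormalCDF_atBot : Tendsto stdNormalCDF atBot (𝓝 0) := by
  rw [funext stdNormalCDF_eq_cdf]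
  exact tendsto_cdf_atBot _

lemma tendsto_stdNormalCDF_atTop : Tendsto stdNormalCDF atTop (𝓝 1) := by
  rw [funext stdNormalCDF_eq_cdf]
  exact tendsto_cdf_atTop _

lemma hasDerivAt_stdNormalCDF (x : ℝ) : HasDerivAt stdNormalCDF (stdNormalPDF x) x := by
  have h : stdNormalCDF = fun y ↦ stdNormalCDF 0 + ∫ z in (0 : ℝ)..y, stdNormalPDF z := by
    ext y
    rw [← intervalIntegral.integral_Iic_sub_Iic integrable_stdNormalPDF.integrableOn
      integrable_stdNormalPDF.integrableOn]
    simp [stdNormalCDF]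
  rw [h]
  exact (continuous_stdNormalPDF.integral_hasStrictDerivAt 0 x).hasDerivAt.const_add _

lemma continuous_stdNormalCDF : Continuous stdNormalCDF :=
  continuous_iff_continuousAt.2 fun x ↦ (hasDerivAt_stdNormalCDF x).continuousAt

lemma integral_stdNormalCDF_pow_gaussianReal (n : ℕ) :
    ∫ x, stdNormalCDF x ^ n ∂gaussianReal 0 1 = 1 / (n + 1) := by
  have hn : (n + 1 : ℝ) ≠ 0 := by positivity
  rw [integral_gaussianReal_eq_integral_stdNormalPDF_mul,
    integral_of_hasDerivAt_of_tendsto (f := fun x ↦ stdNormalCDF x ^ (n + 1) / (n + 1))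
      (m := 0) (n := 1 / (n + 1))]
  · simp
  · intro x
    refine (((hasDerivAt_stdNormalCDF x).pow (n + 1)).div_const _).congr_deriv ?_
    push_cast
    field_simp
  · refine integrable_stdNormalPDF.mul_bdd (c := 1)
      (continuous_stdNormalCDF.pow n).aestronglyMeasurable (ae_of_all _ fun x ↦ ?_)
    rw [norm_pow]
    exact pow_le_one₀ (norm_nonneg _) (abs_stdNormalCDF_le_one x)
  · simpa using (tendsto_stdNormalCDF_atBot.pow (n + 1)).div_const (n + 1 : ℝ)
  · simpa using (tendsto_stdNormalCDF_atTop.pow (n + 1)).div_const (n + 1 : ℝ)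

lemma integrable_stdNormalPDF_sq : Integrable fun x ↦ stdNormalPDF x ^ 2 := by
  refine ((integrable_exp_neg_mul_sq one_pos).const_mul ((Real.sqrt (2 * Real.pi))⁻¹ ^ 2)).congr
    (ae_of_all _ fun x ↦ ?_)
  simp only [stdNormalPDF, mul_pow, ← Real.exp_nat_mul]
  congr 2
  push_cast
  ring

lemma integral_stdNormalPDF_sq : ∫ x, stdNormalPDF x ^ 2 = 1 / (2 * Real.sqrt Real.pi) := by
  have h : ∀ x, stdNormalPDF x ^ 2 = (2 * Real.pi)⁻¹ * Real.exp (-1 * x ^ 2) := fun x ↦ by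
    rw [stdNormalPDF, mul_pow, ← Real.exp_nat_mul, inv_pow, Real.sq_sqrt (by positivity)]
    congr 2
    push_cast
    ring
  simp_rw [h]
  rw [integral_const_mul, integral_gaussian, div_one]
  have := Real.sq_sqrt Real.pi_pos.le
  have := Real.sqrt_pos.2 Real.pi_pos
  field_simp
  assumption

lemma tendsto_stdNormalPDF_cocompact : Tendsto stdNormalPDF (cocompact ℝ) (𝓝 0) := by
  have h := (tendsto_rpow_abs_mul_exp_neg_mul_sq_cocompact (a := 1 / 2) (by norm_num) 0).const_mul
    (Real.sqrt (2 * Real.pi))⁻¹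
  rw [mul_zero] at h
  refine h.congr fun z ↦ ?_
  rw [Real.rpow_zero, one_mul, stdNormalPDF]
  congr 2
  ring

lemma integral_stdNormalCDF_mul_id_gaussianReal :
    ∫ x, stdNormalCDF x * x ∂gaussianReal 0 1 = 1 / (2 * Real.sqrt Real.pi) := by
  have hi : Integrable fun x ↦ stdNormalPDF x * (stdNormalCDF x * x) := by
    refine (integrable_id_mul_stdNormalPDF.mul_bdd (c := 1)
      continuous_stdNormalCDF.aestronglyMeasurable
      (ae_of_all _ abs_stdNormalCDF_le_one)).congr (ae_of_all _ fun x ↦ ?_)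
    ring
  have hlim := cocompact_eq_atBot_atTop (α := ℝ) ▸ tendsto_stdNormalPDF_cocompact
  rw [tendsto_sup] at hlim
  have h := integral_of_hasDerivAt_of_tendsto (m := 0) (n := 0)
    (f := fun x ↦ -(stdNormalPDF x * stdNormalCDF x))
    (f' := fun x ↦ stdNormalPDF x * (stdNormalCDF x * x) - stdNormalPDF x ^ 2)
    (fun x ↦ ((hasDerivAt_stdNormalPDF x).mul (hasDerivAt_stdNormalCDF x)).neg.congr_deriv
      (by ring))
    (hi.sub integrable_stdNormalPDF_sq)
    (by simpa using (hlim.1.mul tendsto_stdNormalCDF_atBot).neg)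
    (by simpa using (hlim.2.mul tendsto_stdNormalCDF_atTop).neg)
  rw [integral_sub hi integrable_stdNormalPDF_sq, integral_stdNormalPDF_sq] at h
  rw [integral_gaussianReal_eq_integral_stdNormalPDF_mul]
  linarith

lemma memLp_stdNormalCDF {μ : Measure ℝ} [IsFiniteMeasure μ] : MemLp stdNormalCDF 2 μ :=
  MemLp.of_bound continuous_stdNormalCDF.aestronglyMeasurable 1
    (ae_of_all _ abs_stdNormalCDF_le_one)

lemma covariance_stdNormalCDF_id_gaussianReal :
    cov[stdNormalCDF, id; gaussianReal 0 1] = 1 / (2 * Real.sqrt Real.pi) := by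
  rw [covariance_eq_sub memLp_stdNormalCDF (memLp_id_gaussianReal 2)]
  simpa using integral_stdNormalCDF_mul_id_gaussianReal

lemma covariance_stdNormalCDF_self_gaussianReal :
    cov[stdNormalCDF, stdNormalCDF; gaussianReal 0 1] = 1 / 12 := by
  have h1 := integral_stdNormalCDF_pow_gaussianReal 1
  have h2 := integral_stdNormalCDF_pow_gaussianReal 2
  simp only [pow_one, pow_two] at h1 h2
  rw [covariance_eq_sub memLp_stdNormalCDF memLp_stdNormalCDF]
  simp only [Pi.mul_apply, h1, h2]
  norm_num

lemma covariance_id_self_gaussianReal (m : ℝ) (v : NNReal) :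
    cov[id, id; gaussianReal m v] = v := by
  rw [covariance_self aemeasurable_id, variance_id_gaussianReal]

theorem stmt_1 {Ω : Type*} [MeasurableSpace Ω] (P : Measure Ω) [IsProbabilityMeasure P]
    (Z₁ W : Ω → ℝ) (hZ₁m : Measurable Z₁) (hWm : Measurable W)
    (hZ₁ : Measure.map Z₁ P = gaussianReal 0 1)
    (hW : Measure.map W P = gaussianReal 0 1)
    (hindep : IndepFun Z₁ W P)
    (ρ : ℝ) (hρ : ρ ∈ Set.Icc (-1 : ℝ) 1)
    (a b μ σ : ℝ) (hab : a < b) (hσ : 0 < σ)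
    (Z₂ X₁ X₂ : Ω → ℝ)
    (hZ₂ : Z₂ = fun ω => ρ * Z₁ ω + Real.sqrt (1 - ρ ^ 2) * W ω)
    (hX₁ : X₁ = fun ω => a + (b - a) * stdNormalCDF (Z₁ ω))
    (hX₂ : X₂ = fun ω => μ + σ * Z₂ ω) :
    cov P X₁ X₂ = ρ * σ * (b - a) / (2 * Real.sqrt Real.pi) ∧
    corr P X₁ X₂ = Real.sqrt (3 / Real.pi) * ρ := by
  set s := Real.sqrt (1 - ρ ^ 2)
  have hs2 : s ^ 2 = 1 - ρ ^ 2 := Real.sq_sqrt (by nlinarith [hρ.1, hρ.2])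
  set U : Ω → ℝ := stdNormalCDF ∘ Z₁
  have memLp_of_map {Z : Ω → ℝ} (hm : Measurable Z) (hZ : P.map Z = gaussianReal 0 1) :
      MemLp Z 2 P :=
    (memLp_map_measure_iff (g := id) aestronglyMeasurable_id hm.aemeasurable).1
      (hZ ▸ memLp_id_gaussianReal (μ := 0) (v := 1) 2)
  have lZ₁ := memLp_of_map hZ₁m hZ₁
  have lW := memLp_of_map hWm hW
  have lU : MemLp U 2 P :=
    (memLp_map_measure_iff continuous_stdNormalCDF.aestronglyMeasurable hZ₁m.aemeasurable).1
      memLp_stdNormalCDF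
  have cont := continuous_stdNormalCDF
  have cUZ : cov[U, Z₁; P] = 1 / (2 * Real.sqrt Real.pi) := by
    rw [← covariance_stdNormalCDF_id_gaussianReal, ← hZ₁, covariance_map
      cont.aestronglyMeasurable aestronglyMeasurable_id hZ₁m.aemeasurable]
    rfl
  have cUU : cov[U, U; P] = 1 / 12 := by
    rw [← covariance_stdNormalCDF_self_gaussianReal, ← hZ₁, covariance_map
      cont.aestronglyMeasurable cont.aestronglyMeasurable hZ₁m.aemeasurable]
  have cov_self {Z : Ω → ℝ} (hm : Measurable Z) (hZ : P.map Z = gaussianReal 0 1) :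
      cov[Z, Z; P] = 1 := by
    rw [← NNReal.coe_one, ← covariance_id_self_gaussianReal 0 1, ← hZ, covariance_map
      aestronglyMeasurable_id aestronglyMeasurable_id hm.aemeasurable]
    rfl
  have cUW : cov[U, W; P] = 0 :=
    (hindep.comp cont.measurable measurable_id).covariance_eq_zero lU lW
  have cZW : cov[Z₁, W; P] = 0 := hindep.covariance_eq_zero lZ₁ lW
  have lZ₂ : MemLp Z₂ 2 P := hZ₂ ▸ (lZ₁.const_mul ρ).add (lW.const_mul s)
  have hZ₂' : Z₂ = ρ • Z₁ + s • W := hZ₂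
  have right_Z₂ {Y : Ω → ℝ} (hY : MemLp Y 2 P) :
      cov[Y, Z₂; P] = ρ * cov[Y, Z₁; P] + s * cov[Y, W; P] := by
    rw [hZ₂', covariance_add_right hY (lZ₁.const_smul ρ) (lW.const_smul s),
      covariance_smul_right, covariance_smul_right]
  have cUZ₂ : cov[U, Z₂; P] = ρ / (2 * Real.sqrt Real.pi) := by
    rw [right_Z₂ lU, cUZ, cUW]
    ring
  have cZ₂Z₂ : cov[Z₂, Z₂; P] = 1 := by
    rw [right_Z₂ lZ₂, covariance_comm Z₂ Z₁, covariance_comm Z₂ W, right_Z₂ lZ₁, right_Z₂ lW,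
      cov_self hZ₁m hZ₁, cov_self hWm hW, covariance_comm W Z₁, cZW]
    linear_combination hs2
  have cov_affine {Y Y' : Ω → ℝ} (hY : MemLp Y 2 P) (hY' : MemLp Y' 2 P) (c d c' d' : ℝ) :
      cov P (fun ω ↦ c + d * Y ω) (fun ω ↦ c' + d' * Y' ω) = d * d' * cov[Y, Y'; P] := by
    have h : MemLp (fun ω ↦ d * Y ω) 2 P := hY.const_mul d
    have h' : MemLp (fun ω ↦ d' * Y' ω) 2 P := hY'.const_mul d'
    have e := covariance_eq_sub (X := fun ω ↦ c + d * Y ω) (Y := fun ω ↦ c' + d' * Y' ω)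
      ((memLp_const c).add h) ((memLp_const c').add h')
    rw [covariance_const_add_left (h.integrable one_le_two),
      covariance_const_add_right (h'.integrable one_le_two), covariance_const_mul_left,
      covariance_const_mul_right] at e
    rw [mul_assoc, e]
    rfl
  have hX₁' : X₁ = fun ω ↦ a + (b - a) * U ω := hX₁
  have c12 : cov P X₁ X₂ = ρ * σ * (b - a) / (2 * Real.sqrt Real.pi) := by
    rw [hX₁', hX₂, cov_affine lU lZ₂, cUZ₂]
    ring
  refine ⟨c12, ?_⟩
  have hba : 0 < b - a := sub_pos.2 hab
  have hsd : Real.sqrt (cov P X₁ X₁ * cov P X₂ X₂) = (b - a) * σ / (2 * Real.sqrt 3) := by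
    rw [hX₁', hX₂, cov_affine lU lU, cov_affine lZ₂ lZ₂, cUU, cZ₂Z₂,
      Real.sqrt_eq_iff_mul_self_eq (by positivity) (by positivity)]
    have := Real.sq_sqrt (show (0 : ℝ) ≤ 3 by norm_num)
    field_simp
    rw [this]
    norm_num
  rw [corr, c12, hsd, Real.sqrt_div (by norm_num)]
  have := Real.sqrt_pos.2 Real.pi_pos
  field_simp
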